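/- Converse part of the sphere-covering theorem: for D ∈ [0, D_max) and R(D;P,M) < R < log M(A), every sequence of sets C_n ⊆ A^n with limsup_n (1/n) log M^n(C_n) ≤ R satisfies liminf_n −(1/n) log [1 − P^n([C_n]_D)] ≤ E*(R,D), where E*(R,D) = inf{ H(Q‖P) : R(D;Q,M) > R }. -/

import Mathlib

open Finset Filter

attribute [local instance] Classical.propDecidable

/-- Normalized single-letter distortion on `A^n`. -/
noncomputable def rhoN {A : Type*} (ρ : A → A → ℝ) (n : ℕ)
    (x y : Fin n → A) : ℝ := (1 / (n : ℝ)) * ∑ i, ρ (x i) (y i)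

/-- The `D`-blowup of `C ⊆ A^n`. -/
noncomputable def blowup {A : Type*} [Fintype A] (ρ : A → A → ℝ) (n : ℕ)
    (C : Finset (Fin n → A)) (D : ℝ) : Finset (Fin n → A) :=
  Finset.univ.filter (fun x => ∃ y ∈ C, rhoN ρ n x y ≤ D)

/-- Product probability of a subset of `A^n`. -/
noncomputable def prodProb {A : Type*} [Fintype A] (P : A → ℝ) (n : ℕ)
    (C : Finset (Fin n → A)) : ℝ := ∑ x ∈ C, ∏ i, P (x i)

/-- Product mass `M^n(C)` of a subset of `A^n`. -/
noncomputable def massN {A : Type*} [Fintype A] (M : A → ℝ) (n : ℕ)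
    (C : Finset (Fin n → A)) : ℝ := ∑ y ∈ C, ∏ i, M (y i)

/-- Base-2 relative entropy. -/
noncomputable def relEnt {A : Type*} [Fintype A] (Q P : A → ℝ) : ℝ :=
  ∑ a, Q a * Real.logb 2 (Q a / P a)

/-- The rate-function `R(D;Q,M)` (infimum over the empty set is `⊤`). -/
noncomputable def rate {A : Type*} [Fintype A] (ρ : A → A → ℝ)
    (Q M : A → ℝ) (D : ℝ) : EReal :=
  sInf { x : EReal | ∃ W : A × A → ℝ,
    (∀ p, 0 ≤ W p) ∧
    (∀ a, (∑ b, W (a, b)) = Q a) ∧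
    (∑ p : A × A, W p * ρ p.1 p.2) ≤ D ∧
    x = (((∑ p : A × A,
            W p * Real.logb 2 (W p / (Q p.1 * ∑ a, W (a, p.2)))) +
          ∑ p : A × A, W p * Real.logb 2 (M p.2) : ℝ) : EReal) }

/-- `E*(R,D) = inf { H(Q‖P) : R(D;Q,M) > R }`. -/
noncomputable def Estar {A : Type*} [Fintype A] (ρ : A → A → ℝ)
    (P M : A → ℝ) (D : ℝ) (R : ℝ) : EReal :=
  sInf { x : EReal | ∃ Q : A → ℝ,
    (∀ a, 0 ≤ Q a) ∧ (∑ a, Q a = 1) ∧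
    (R : EReal) < rate ρ Q M D ∧ x = ((relEnt Q P : ℝ) : EReal) }

/-- The total of a product function over all words factors as a product of single-letter totals. -/
theorem sum_words_prod {A : Type*} [Fintype A] (n : ℕ) (g : Fin n → A → ℝ) :
    ∑ x : Fin n → A, ∏ i, g i (x i) = ∏ i, ∑ a, g i a := by
  rw [Finset.prod_univ_sum, Fintype.piFinset_univ]

theorem sum_words_iid {A : Type*} [Fintype A] (Q : A → ℝ) (hsum : ∑ a, Q a = 1) (n : ℕ) :
    ∑ x : Fin n → A, ∏ i, Q (x i) = 1 := by
  rw [sum_words_prod n (fun _ => Q)]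
  simp [hsum]

/-- Each coordinate of an i.i.d. word has the single-letter law. -/
theorem sum_words_marginal {A : Type*} [Fintype A] (Q : A → ℝ) (hsum : ∑ a, Q a = 1)
    (n : ℕ) (i : Fin n) (h : A → ℝ) :
    ∑ x : Fin n → A, (∏ j, Q (x j)) * h (x i) = ∑ a, Q a * h a := by
  have h1 : ∀ x : Fin n → A, (∏ j, Q (x j)) * h (x i)
      = ∏ j, (Q (x j) * if j = i then h (x j) else 1) := by
    intro x
    rw [Finset.prod_mul_distrib]
    simp
  simp_rw [h1]
  rw [sum_words_prod n (fun j a => Q a * if j = i then h a else 1),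
    Finset.prod_eq_single i]
  · simp
  · intro j _ hj
    simp [hj, hsum]
  · simp

/-- The empirical joint law of a letter of an i.i.d. `Q` word and of its reproduction under `f`. -/
noncomputable def codingLaw {A : Type*} [Fintype A] (Q : A → ℝ) (n : ℕ)
    (f : (Fin n → A) → (Fin n → A)) (p : A × A) : ℝ :=
  (1 / (n : ℝ)) * ∑ x, (∏ j, Q (x j)) * ∑ i, if (x i, f x i) = p then 1 else 0

theorem sum_codingLaw_mul {A : Type*} [Fintype A] (Q : A → ℝ) (n : ℕ)
    (f : (Fin n → A) → (Fin n → A)) (g : A × A → ℝ) :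
    ∑ p, codingLaw Q n f p * g p
      = (1 / (n : ℝ)) * ∑ x, (∏ j, Q (x j)) * ∑ i, g (x i, f x i) := by
  simp only [codingLaw, Finset.mul_sum, Finset.sum_mul]
  rw [Finset.sum_comm]
  refine Finset.sum_congr rfl fun x _ => ?_
  rw [Finset.sum_comm]
  refine Finset.sum_congr rfl fun i _ => ?_
  rw [Finset.sum_eq_single (x i, f x i)]
  · simp; ring
  · intro b _ hb
    simp [hb.symm]
  · simp

theorem codingLaw_nonneg {A : Type*} [Fintype A] (Q : A → ℝ) (hQ : ∀ a, 0 ≤ Q a) (n : ℕ)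
    (f : (Fin n → A) → (Fin n → A)) (p : A × A) : 0 ≤ codingLaw Q n f p := by
  unfold codingLaw
  refine mul_nonneg (by positivity) (Finset.sum_nonneg fun x _ => ?_)
  refine mul_nonneg (Finset.prod_nonneg fun i _ => hQ _) (Finset.sum_nonneg fun i _ => ?_)
  split_ifs <;> norm_num

theorem codingLaw_pos {A : Type*} [Fintype A] (Q : A → ℝ) (hQ : ∀ a, 0 ≤ Q a) (n : ℕ)
    (f : (Fin n → A) → (Fin n → A)) (x : Fin n → A) (hx : 0 < ∏ j, Q (x j)) (i : Fin n) :
    0 < codingLaw Q n f (x i, f x i) := by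
  have hn : (0 : ℝ) < n := by exact_mod_cast i.pos
  have hind : ∀ (z : Fin n → A) (j : Fin n),
      (0 : ℝ) ≤ if (z j, f z j) = (x i, f x i) then 1 else 0 := by
    intro z j
    split_ifs <;> norm_num
  refine mul_pos (by positivity) (Finset.sum_pos' (fun z _ => ?_) ⟨x, Finset.mem_univ _, ?_⟩)
  · exact mul_nonneg (Finset.prod_nonneg fun i _ => hQ _) (Finset.sum_nonneg fun j _ => hind z j)
  · exact mul_pos hx (Finset.sum_pos' (fun j _ => hind x j) ⟨i, Finset.mem_univ _, by simp⟩)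

theorem sum_codingLaw {A : Type*} [Fintype A] (Q : A → ℝ) (hsum : ∑ a, Q a = 1) (n : ℕ)
    (hn : 0 < n) (f : (Fin n → A) → (Fin n → A)) (a : A) :
    ∑ b, codingLaw Q n f (a, b) = Q a := by
  have h := sum_codingLaw_mul Q n f (fun p => if p.1 = a then 1 else 0)
  have hl : ∑ p : A × A, codingLaw Q n f p * (if p.1 = a then 1 else 0)
      = ∑ b, codingLaw Q n f (a, b) := by
    rw [Fintype.sum_prod_type, Finset.sum_eq_single a]
    · simp
    · intro b _ hb
      simp [hb]
    · simp
  rw [← hl, h]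
  simp only [Finset.mul_sum]
  rw [Finset.sum_comm]
  have hi : ∀ i : Fin n, ∑ x : Fin n → A,
      (1 / (n : ℝ)) * ((∏ j, Q (x j)) * if x i = a then 1 else 0) = (1 / (n : ℝ)) * Q a := by
    intro i
    rw [← Finset.mul_sum, sum_words_marginal Q hsum n i (fun c => if c = a then 1 else 0)]
    simp
  rw [Finset.sum_congr rfl fun i _ => hi i]
  have : (n : ℝ) ≠ 0 := by positivity
  simp
  field_simp

/-- The objective of the rate function. -/
noncomputable def rateObj {A : Type*} [Fintype A] (Q M : A → ℝ) (W : A × A → ℝ) : ℝ :=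
  (∑ p : A × A, W p * Real.logb 2 (W p / (Q p.1 * ∑ a, W (a, p.2)))) +
    ∑ p : A × A, W p * Real.logb 2 (M p.2)

/-- Jensen's inequality for `log`, with zero weights allowed on nonpositive values. -/
theorem sum_mul_logb_le {ι : Type*} [Fintype ι] (q t : ι → ℝ) (hq : ∀ x, 0 ≤ q x)
    (hsum : ∑ x, q x = 1) (ht : ∀ x, 0 < q x → 0 < t x) (S : ℝ) (hS : 0 < S)
    (hle : ∑ x, q x * t x ≤ S) : ∑ x, q x * Real.logb 2 (t x) ≤ Real.logb 2 S := by
  have hl2 : 0 < Real.log 2 := Real.log_pos (by norm_num)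
  have key : ∀ x, q x * Real.log (t x) ≤ q x * t x / S + q x * (Real.log S - 1) := by
    intro x
    rcases (hq x).eq_or_lt with h | h
    · simp [← h]
    · have h1 := Real.log_le_sub_one_of_pos (div_pos (ht x h) hS)
      rw [Real.log_div (ht x h).ne' hS.ne'] at h1
      have := mul_le_mul_of_nonneg_left h1 h.le
      have e : q x * t x / S = q x * (t x / S) := by ring
      rw [e]
      linarith
  have h2 : ∑ x, q x * Real.log (t x) ≤ Real.log S := by
    refine (Finset.sum_le_sum fun x _ => key x).trans ?_
    rw [Finset.sum_add_distrib, ← Finset.sum_div, ← Finset.sum_mul, hsum]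
    have : (∑ x, q x * t x) / S ≤ 1 := (div_le_one hS).2 hle
    linarith
  simp only [Real.logb, ← mul_div_assoc]
  rw [← Finset.sum_div]
  gcongr

theorem massN_pos {A : Type*} [Fintype A] (M : A → ℝ) (hM : ∀ a, 0 < M a) (n : ℕ)
    (C : Finset (Fin n → A)) (hC : C.Nonempty) : 0 < massN M n C :=
  Finset.sum_pos (fun _ _ => Finset.prod_pos fun _ _ => hM _) hC

/-- A joint weight `W`, relative to `Q` and its second marginal, tilts the mass of a code
by a total of at most `massN`. -/
theorem sum_words_tilt_le_massN {A : Type*} [Fintype A] (Q M : A → ℝ) (hQ : ∀ a, 0 ≤ Q a)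
    (hM : ∀ a, 0 < M a) (W : A × A → ℝ) (hW : ∀ p, 0 ≤ W p) (n : ℕ)
    (C : Finset (Fin n → A)) (f : (Fin n → A) → (Fin n → A)) (hf : ∀ x, f x ∈ C) :
    ∑ x : Fin n → A, (∏ j, Q (x j)) *
      ∏ i, (W (x i, f x i) / (Q (x i) * ∑ a, W (a, f x i)) * M (f x i)) ≤ massN M n C := by
  have hV : ∀ b, 0 ≤ ∑ a, W (a, b) := fun b => Finset.sum_nonneg fun a _ => hW _
  have hG : ∀ a b, 0 ≤ W (a, b) / (Q a * ∑ c, W (c, b)) * M b := fun a b =>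
    mul_nonneg (div_nonneg (hW _) (mul_nonneg (hQ _) (hV _))) (hM _).le
  have hq : ∀ x : Fin n → A, 0 ≤ ∏ j, Q (x j) := fun x => Finset.prod_nonneg fun i _ => hQ _
  have hletter : ∀ b, ∑ a, Q a * (W (a, b) / (Q a * ∑ c, W (c, b)) * M b) ≤ M b := by
    intro b
    calc ∑ a, Q a * (W (a, b) / (Q a * ∑ c, W (c, b)) * M b)
        ≤ ∑ a, W (a, b) / (∑ c, W (c, b)) * M b := by
          refine Finset.sum_le_sum fun a _ => ?_
          rw [← mul_assoc]
          refine mul_le_mul_of_nonneg_right ?_ (hM _).le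
          rcases (hQ a).eq_or_lt with h | h
          · rw [← h, zero_mul]
            exact div_nonneg (hW _) (hV _)
          · rw [← div_div, div_right_comm, mul_div_cancel₀ _ h.ne']
      _ = (∑ a, W (a, b)) / (∑ c, W (c, b)) * M b := by rw [← Finset.sum_mul, ← Finset.sum_div]
      _ ≤ M b := mul_le_of_le_one_left (hM _).le (div_self_le_one _)
  calc _ ≤ ∑ x : Fin n → A, ∑ y ∈ C, (∏ j, Q (x j)) *
          ∏ i, (W (x i, y i) / (Q (x i) * ∑ a, W (a, y i)) * M (y i)) := by
        refine Finset.sum_le_sum fun x _ => ?_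
        exact Finset.single_le_sum (f := fun y => (∏ j, Q (x j)) *
            ∏ i, (W (x i, y i) / (Q (x i) * ∑ a, W (a, y i)) * M (y i)))
          (fun y _ => mul_nonneg (hq x) (Finset.prod_nonneg fun i _ => hG _ _)) (hf x)
    _ = ∑ y ∈ C, ∏ i, ∑ a, Q a * (W (a, y i) / (Q a * ∑ c, W (c, y i)) * M (y i)) := by
        rw [Finset.sum_comm]
        refine Finset.sum_congr rfl fun y _ => ?_
        rw [← sum_words_prod n
          (fun i a => Q a * (W (a, y i) / (Q a * ∑ c, W (c, y i)) * M (y i)))]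
        exact Finset.sum_congr rfl fun x _ => Finset.prod_mul_distrib.symm
    _ ≤ massN M n C := Finset.sum_le_sum fun y _ =>
        Finset.prod_le_prod (fun i _ => Finset.sum_nonneg fun a _ => mul_nonneg (hQ _) (hG _ _))
          fun i _ => hletter _

/-- Weak converse: a code of small mass yields an empirical joint law of small rate. -/
theorem rateObj_codingLaw_le {A : Type*} [Fintype A] (Q M : A → ℝ) (hQ : ∀ a, 0 ≤ Q a)
    (hsum : ∑ a, Q a = 1) (hM : ∀ a, 0 < M a) (n : ℕ) (C : Finset (Fin n → A))
    (hC : C.Nonempty) (f : (Fin n → A) → (Fin n → A)) (hf : ∀ x, f x ∈ C) :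
    rateObj Q M (codingLaw Q n f) ≤ (1 / (n : ℝ)) * Real.logb 2 (massN M n C) := by
  have hWnn : ∀ p, 0 ≤ codingLaw Q n f p := codingLaw_nonneg Q hQ n f
  have hWpos := codingLaw_pos Q hQ n f
  have hWsum := sum_codingLaw_mul Q n f
  generalize codingLaw Q n f = W at hWnn hWpos hWsum ⊢
  have hq : ∀ x : Fin n → A, 0 ≤ ∏ j, Q (x j) := fun x => Finset.prod_nonneg fun i _ => hQ _
  have hpos : ∀ x : Fin n → A, 0 < ∏ j, Q (x j) → ∀ i,
      0 < W (x i, f x i) / (Q (x i) * ∑ a, W (a, f x i)) := by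
    intro x hx i
    have h1 : 0 < W (x i, f x i) := hWpos x hx i
    have h2 : 0 < Q (x i) := (hQ _).lt_of_ne fun h =>
      hx.ne' (Finset.prod_eq_zero (Finset.mem_univ i) h.symm)
    have h3 : 0 < ∑ a, W (a, f x i) :=
      h1.trans_le (Finset.single_le_sum (f := fun a => W (a, f x i))
        (fun a _ => hWnn _) (Finset.mem_univ (x i)))
    exact div_pos h1 (mul_pos h2 h3)
  have hobj : rateObj Q M W = (1 / (n : ℝ)) * ∑ x, (∏ j, Q (x j)) *
      Real.logb 2 (∏ i, (W (x i, f x i) / (Q (x i) * ∑ a, W (a, f x i)) * M (f x i))) := by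
    have h0 : rateObj Q M W = ∑ p : A × A, W p *
        (Real.logb 2 (W p / (Q p.1 * ∑ a, W (a, p.2))) + Real.logb 2 (M p.2)) := by
      simp only [rateObj, mul_add, Finset.sum_add_distrib]
    rw [h0, hWsum]
    congr 1
    refine Finset.sum_congr rfl fun x _ => ?_
    rcases (hq x).eq_or_lt with h | h
    · rw [← h, zero_mul, zero_mul]
    · rw [Real.logb_prod _ _ fun i _ => (mul_pos (hpos x h i) (hM _)).ne']
      congr 1
      refine Finset.sum_congr rfl fun i _ => ?_
      rw [Real.logb_mul (hpos x h i).ne' (hM _).ne']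
  rw [hobj]
  refine mul_le_mul_of_nonneg_left ?_ (by positivity)
  exact sum_mul_logb_le _ _ hq (sum_words_iid Q hsum n)
    (fun x hx => Finset.prod_pos fun i _ => mul_pos (hpos x hx i) (hM _)) _
    (massN_pos M hM n C hC) (sum_words_tilt_le_massN Q M hQ hM W hWnn n C f hf)

/-- Couplings with first marginal `Q` form a compact set. -/
theorem isCompact_couplings {A : Type*} [Fintype A] (Q : A → ℝ) :
    IsCompact {W : A × A → ℝ | (∀ p, 0 ≤ W p) ∧ ∀ a, ∑ b, W (a, b) = Q a} := by
  refine (isCompact_univ_pi fun p : A × A =>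
    isCompact_Icc (a := (0 : ℝ)) (b := Q p.1)).of_isClosed_subset ?_ ?_
  · have h : {W : A × A → ℝ | (∀ p, 0 ≤ W p) ∧ ∀ a, ∑ b, W (a, b) = Q a}
        = (⋂ p, {W | 0 ≤ W p}) ∩ ⋂ a, {W | ∑ b, W (a, b) = Q a} := by
      ext W
      simp
    rw [h]
    exact (isClosed_iInter fun p => isClosed_le continuous_const (continuous_apply p)).inter
      (isClosed_iInter fun a => isClosed_eq (by fun_prop) continuous_const)
  · rintro W ⟨h0, h1⟩ p -
    refine ⟨h0 p, ?_⟩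
    rw [← h1 p.1]
    exact Finset.single_le_sum (f := fun b => W (p.1, b)) (fun b _ => h0 _) (Finset.mem_univ p.2)

/-- The rate objective is continuous on couplings with first marginal `Q`. -/
theorem continuousOn_rateObj {A : Type*} [Fintype A] (Q M : A → ℝ) :
    ContinuousOn (rateObj Q M)
      {W : A × A → ℝ | (∀ p, 0 ≤ W p) ∧ ∀ a, ∑ b, W (a, b) = Q a} := by
  have hcont : Continuous fun W : A × A → ℝ =>
      ((∑ p : A × A, (W p * Real.log (W p) - W p * Real.log (Q p.1)))
        - ∑ b, (∑ a, W (a, b)) * Real.log (∑ a, W (a, b))) / Real.log 2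
        + ∑ p : A × A, W p * Real.logb 2 (M p.2) := by
    have h1 : ∀ p : A × A, Continuous fun W : A × A → ℝ => W p * Real.log (W p) :=
      fun p => Real.continuous_mul_log.comp (continuous_apply p)
    have h2 : ∀ b : A, Continuous fun W : A × A → ℝ =>
        (∑ a, W (a, b)) * Real.log (∑ a, W (a, b)) :=
      fun b => Real.continuous_mul_log.comp (by fun_prop)
    refine Continuous.add (Continuous.div_const (Continuous.sub ?_ ?_) _) (by fun_prop)
    · exact continuous_finsetSum _ fun p _ => (h1 p).sub (by fun_prop)
    · exact continuous_finsetSum _ fun b _ => h2 b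
  refine hcont.continuousOn.congr ?_
  rintro W ⟨h0, h1⟩
  unfold rateObj
  congr 1
  have h2 : ∑ b, (∑ a, W (a, b)) * Real.log (∑ a, W (a, b))
      = ∑ p : A × A, W p * Real.log (∑ a, W (a, p.2)) := by
    rw [Fintype.sum_prod_type_right]
    exact Finset.sum_congr rfl fun b _ => by rw [Finset.sum_mul]
  rw [h2, ← Finset.sum_sub_distrib, Finset.sum_div]
  refine Finset.sum_congr rfl fun p _ => ?_
  rcases (h0 p).eq_or_lt with h | h
  · simp [← h]
  · have hQ : 0 < Q p.1 := by
      rw [← h1]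
      exact h.trans_le (Finset.single_le_sum (f := fun b => W (p.1, b)) (fun b _ => h0 _)
        (Finset.mem_univ p.2))
    have hV : 0 < ∑ a, W (a, p.2) :=
      h.trans_le (Finset.single_le_sum (f := fun a => W (a, p.2)) (fun b _ => h0 _)
        (Finset.mem_univ p.1))
    rw [Real.logb, Real.log_div h.ne' (mul_pos hQ hV).ne', Real.log_mul hQ.ne' hV.ne']
    ring

/-- Right-continuity of the rate function: if the rate at `D` exceeds `R'`, couplings of objective
at most `R'` have distortion bounded away from `D`. -/
theorem exists_lt_distortion {A : Type*} [Fintype A] (ρ : A → A → ℝ) (Q M : A → ℝ) (D R' : ℝ)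
    (h : (R' : EReal) < rate ρ Q M D) :
    ∃ D' > D, ∀ W : A × A → ℝ, (∀ p, 0 ≤ W p) → (∀ a, ∑ b, W (a, b) = Q a) →
      rateObj Q M W ≤ R' → D' ≤ ∑ p : A × A, W p * ρ p.1 p.2 := by
  set K := {W : A × A → ℝ | (∀ p, 0 ≤ W p) ∧ ∀ a, ∑ b, W (a, b) = Q a} with hK
  have hKc : IsCompact K := isCompact_couplings Q
  have hK' : IsCompact (K ∩ rateObj Q M ⁻¹' Set.Iic R') :=
    hKc.of_isClosed_subset
      ((continuousOn_rateObj Q M).preimage_isClosed_of_isClosed hKc.isClosed isClosed_Iic)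
      Set.inter_subset_left
  rcases (K ∩ rateObj Q M ⁻¹' Set.Iic R').eq_empty_or_nonempty with he | hne
  · refine ⟨D + 1, by linarith, fun W h0 h1 h2 => ?_⟩
    exact absurd (show W ∈ K ∩ rateObj Q M ⁻¹' Set.Iic R' from ⟨⟨h0, h1⟩, h2⟩) (by simp [he])
  · obtain ⟨W₀, ⟨⟨h0, h1⟩, h2⟩, hmin⟩ := hK'.exists_isMinOn hne
      (f := fun W => ∑ p : A × A, W p * ρ p.1 p.2) (by fun_prop)
    refine ⟨∑ p : A × A, W₀ p * ρ p.1 p.2, ?_, fun W g0 g1 g2 => hmin ⟨⟨g0, g1⟩, g2⟩⟩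
    by_contra hcon
    have hle : rate ρ Q M D ≤ (rateObj Q M W₀ : EReal) :=
      sInf_le ⟨W₀, h0, h1, not_lt.1 hcon, rfl⟩
    have := EReal.coe_lt_coe_iff.1 (h.trans_le hle)
    exact absurd h2 (not_le.2 this)

/-- An exponential bound on the upper tail of an i.i.d. sum. -/
theorem exists_tail_bound {A : Type*} [Fintype A] (Q Z : A → ℝ) (hQ : ∀ a, 0 ≤ Q a)
    (hsum : ∑ a, Q a = 1) (ε : ℝ) (hε : 0 < ε) :
    ∃ r, 0 ≤ r ∧ r < 1 ∧ ∀ n : ℕ,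
      ∑ x : Fin n → A with n * ((∑ a, Q a * Z a) + ε) < ∑ i, Z (x i), ∏ i, Q (x i) ≤ r ^ n := by
  set m := (∑ a, Q a * Z a) + ε with hm
  set φ : ℝ → ℝ := fun s => ∑ a, Q a * Real.exp (s * (Z a - m)) with hφ
  have hderiv : HasDerivAt φ (-ε) 0 := by
    have h1 : ∀ a, HasDerivAt (fun s => Q a * Real.exp (s * (Z a - m))) (Q a * (Z a - m)) 0 := by
      intro a
      have := (((hasDerivAt_id (0 : ℝ)).mul_const (Z a - m)).exp).const_mul (Q a)
      simpa using this
    have h2 := HasDerivAt.fun_sum (u := Finset.univ) fun a _ => h1 a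
    have h3 : ∑ a, Q a * (Z a - m) = -ε := by
      simp only [mul_sub, Finset.sum_sub_distrib]
      rw [← Finset.sum_mul, hsum, hm]
      ring
    rwa [h3] at h2
  have h0 : φ 0 = 1 := by simp [hφ, hsum]
  obtain ⟨s, hs, hs1⟩ : ∃ s, 0 < s ∧ φ s < 1 := by
    have h1 := (hasDerivAt_iff_tendsto_slope.1 hderiv).mono_left
      (nhdsWithin_mono 0 (show Set.Ioi (0 : ℝ) ⊆ {0}ᶜ from fun x hx => ne_of_gt hx))
    have h2 := (h1.eventually_lt_const (show -ε < 0 by linarith)).and self_mem_nhdsWithin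
    obtain ⟨s, hs, hs0⟩ := h2.exists
    refine ⟨s, hs0, ?_⟩
    rw [slope_def_field, h0, sub_zero, div_neg_iff] at hs
    have : (0 : ℝ) < s := hs0
    rcases hs with h | h
    · linarith [h.2]
    · linarith [h.1]
  refine ⟨φ s, Finset.sum_nonneg fun a _ => mul_nonneg (hQ a) (Real.exp_pos _).le, hs1,
    fun n => ?_⟩
  have hnn : ∀ x : Fin n → A, 0 ≤ ∏ i, Q (x i) := fun x => Finset.prod_nonneg fun i _ => hQ _
  have hexp : ∀ x : Fin n → A, ∏ i, (Q (x i) * Real.exp (s * (Z (x i) - m)))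
      = (∏ i, Q (x i)) * Real.exp (s * ((∑ i, Z (x i)) - n * m)) := by
    intro x
    rw [Finset.prod_mul_distrib, ← Real.exp_sum, ← Finset.mul_sum, Finset.sum_sub_distrib]
    simp
  calc ∑ x : Fin n → A with n * m < ∑ i, Z (x i), ∏ i, Q (x i)
      ≤ ∑ x : Fin n → A with n * m < ∑ i, Z (x i),
          ∏ i, (Q (x i) * Real.exp (s * (Z (x i) - m))) := by
        refine Finset.sum_le_sum fun x hx => ?_
        rw [hexp]
        refine le_mul_of_one_le_right (hnn x) (Real.one_le_exp ?_)
        exact mul_nonneg hs.le (sub_nonneg.2 (Finset.mem_filter.1 hx).2.le)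
    _ ≤ ∑ x : Fin n → A, ∏ i, (Q (x i) * Real.exp (s * (Z (x i) - m))) :=
        Finset.sum_le_sum_of_subset_of_nonneg (Finset.filter_subset _ _) fun x _ _ => by
          rw [hexp]
          exact mul_nonneg (hnn x) (Real.exp_pos _).le
    _ = φ s ^ n := by
        rw [sum_words_prod n (fun _ a => Q a * Real.exp (s * (Z a - m)))]
        simp [hφ]

/-- Change of measure on words of bounded log-likelihood ratio. -/
theorem prod_le_rpow_mul_prod {A : Type*} [Fintype A] (Q P : A → ℝ) (hQ : ∀ a, 0 ≤ Q a)
    (hP : ∀ a, 0 < P a) (n : ℕ) (x : Fin n → A) (t : ℝ)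
    (ht : ∑ i, Real.logb 2 (Q (x i) / P (x i)) ≤ t) :
    ∏ i, Q (x i) ≤ (2 : ℝ) ^ t * ∏ i, P (x i) := by
  have hPp : 0 < ∏ i, P (x i) := Finset.prod_pos fun i _ => hP _
  rcases (Finset.prod_nonneg fun i _ => hQ (x i) : 0 ≤ ∏ i, Q (x i)).eq_or_lt with h | h
  · rw [← h]
    positivity
  · have hQp : ∀ i, 0 < Q (x i) := fun i => (hQ _).lt_of_ne fun h' =>
      h.ne' (Finset.prod_eq_zero (Finset.mem_univ i) h'.symm)
    rw [← Real.logb_prod _ _ fun i _ => (div_pos (hQp i) (hP _)).ne',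
      Finset.prod_div_distrib, Real.logb_le_iff_le_rpow (by norm_num) (div_pos h hPp),
      div_le_iff₀ hPp] at ht
    exact ht

/-- Stein's lemma, converse part: a set of `Q`-probability at least `δ` cannot have
`P`-probability decaying faster than `H(Q‖P)`. -/
theorem eventually_le_prodProb {A : Type*} [Fintype A] (Q P : A → ℝ) (hQ : ∀ a, 0 ≤ Q a)
    (hsum : ∑ a, Q a = 1) (hP : ∀ a, 0 < P a) (δ ε : ℝ) (hδ : 0 < δ) (hε : 0 < ε) :
    ∀ᶠ n : ℕ in atTop, ∀ B : Finset (Fin n → A), δ ≤ prodProb Q n B →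
      δ / 2 ≤ (2 : ℝ) ^ (n * (relEnt Q P + ε)) * prodProb P n B := by
  obtain ⟨r, hr0, hr1, hr⟩ :=
    exists_tail_bound Q (fun a => Real.logb 2 (Q a / P a)) hQ hsum ε hε
  have hlim := tendsto_pow_atTop_nhds_zero_of_lt_one hr0 hr1
  filter_upwards [hlim.eventually_lt_const (half_pos hδ)] with n hn B hB
  have hr' := hr n
  change ∑ x : Fin n → A with n * (relEnt Q P + ε) < ∑ i, Real.logb 2 (Q (x i) / P (x i)),
    ∏ i, Q (x i) ≤ r ^ n at hr'
  set c := (n : ℝ) * (relEnt Q P + ε)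
  set T : Finset (Fin n → A) := {x | c < ∑ i, Real.logb 2 (Q (x i) / P (x i))} with hT
  have h1 : prodProb Q n B ≤ (2 : ℝ) ^ c * prodProb P n B + ∑ x ∈ T, ∏ i, Q (x i) := by
    unfold prodProb
    have hnn : ∀ x : Fin n → A, 0 ≤ ∏ i, Q (x i) := fun x => Finset.prod_nonneg fun i _ => hQ _
    rw [← Finset.sum_filter_add_sum_filter_not B (· ∈ T), add_comm]
    refine add_le_add ?_ ?_
    · rw [Finset.mul_sum]
      refine (Finset.sum_le_sum fun x hx => ?_).trans
        (Finset.sum_le_sum_of_subset_of_nonneg (Finset.filter_subset (· ∉ T) B) fun x _ _ => ?_)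
      · refine prod_le_rpow_mul_prod Q P hQ hP n x c ?_
        simpa [hT] using (Finset.mem_filter.1 hx).2
      · exact mul_nonneg (by positivity) (Finset.prod_nonneg fun i _ => (hP _).le)
    · exact Finset.sum_le_sum_of_subset_of_nonneg
        (fun x hx => (Finset.mem_filter.1 hx).2) fun x _ _ => hnn x
  linarith

theorem prodProb_compl {A : Type*} [Fintype A] (P : A → ℝ) (hsum : ∑ a, P a = 1) (n : ℕ)
    (B : Finset (Fin n → A)) : 1 - prodProb P n B = prodProb P n Bᶜ := by
  rw [← sum_words_iid P hsum n, prodProb, prodProb, ← Finset.sum_add_sum_compl B]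
  ring

/-- A code whose normalized log-mass is below the rate at `D` leaves a fixed fraction of the
`Q`-probability uncovered. -/
theorem exists_le_uncovered {A : Type*} [Fintype A] (ρ : A → A → ℝ) (hρ : ∀ a b, 0 ≤ ρ a b)
    (Q M : A → ℝ) (hQ : ∀ a, 0 ≤ Q a) (hsum : ∑ a, Q a = 1) (hM : ∀ a, 0 < M a)
    (D R' : ℝ) (hD : 0 ≤ D) (h : (R' : EReal) < rate ρ Q M D) :
    ∃ δ > 0, ∀ (n : ℕ) (C : Finset (Fin n → A)), 0 < n →
      (1 / (n : ℝ)) * Real.logb 2 (massN M n C) ≤ R' →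
      δ ≤ prodProb Q n (blowup ρ n C D)ᶜ := by
  obtain ⟨D', hD', hmin⟩ := exists_lt_distortion ρ Q M D R' h
  set K : ℝ := 1 + ∑ p : A × A, ρ p.1 p.2 with hK
  have hsumρ : 0 ≤ ∑ p : A × A, ρ p.1 p.2 := Finset.sum_nonneg fun p _ => hρ _ _
  have hKpos : 0 < K := by linarith
  have hρK : ∀ a b, ρ a b ≤ K := by
    intro a b
    have := Finset.single_le_sum (f := fun p : A × A => ρ p.1 p.2) (fun p _ => hρ _ _)
      (Finset.mem_univ (a, b))
    simp only at this
    linarith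
  refine ⟨min 1 ((D' - D) / K), lt_min one_pos (div_pos (sub_pos.2 hD') hKpos),
    fun n C hn hCR => ?_⟩
  rcases C.eq_empty_or_nonempty with rfl | hC
  · have : (blowup ρ n ∅ D)ᶜ = Finset.univ := by simp [blowup]
    rw [this, prodProb, sum_words_iid Q hsum]
    exact min_le_left _ _
  refine (min_le_right _ _).trans ?_
  have hn' : (0 : ℝ) < n := by exact_mod_cast hn
  choose f hfC hfmin using fun x : Fin n → A => C.exists_min_image (rhoN ρ n x) hC
  have h1 := hmin (codingLaw Q n f) (codingLaw_nonneg Q hQ n f) (sum_codingLaw Q hsum n hn f)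
    ((rateObj_codingLaw_le Q M hQ hsum hM n C hC f hfC).trans hCR)
  rw [sum_codingLaw_mul Q n f (fun p => ρ p.1 p.2)] at h1
  have h2 : (1 / (n : ℝ)) * ∑ x, (∏ j, Q (x j)) * ∑ i, ρ (x i) (f x i)
      = ∑ x, (∏ j, Q (x j)) * rhoN ρ n x (f x) := by
    rw [Finset.mul_sum]
    refine Finset.sum_congr rfl fun x _ => ?_
    rw [rhoN]
    ring
  have hnn : ∀ x : Fin n → A, 0 ≤ ∏ i, Q (x i) := fun x => Finset.prod_nonneg fun i _ => hQ _
  have hrhoK : ∀ x y, rhoN ρ n x y ≤ K := by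
    intro x y
    have : ∑ i, ρ (x i) (y i) ≤ n * K := by
      refine (Finset.sum_le_sum fun i _ => hρK _ _).trans ?_
      simp
    rw [rhoN, one_div, inv_mul_le_iff₀ hn']
    exact this
  have h3 : ∑ x, (∏ j, Q (x j)) * rhoN ρ n x (f x)
      ≤ D + K * prodProb Q n (blowup ρ n C D)ᶜ := by
    rw [← Finset.sum_add_sum_compl (blowup ρ n C D)]
    refine add_le_add ?_ ?_
    · calc ∑ x ∈ blowup ρ n C D, (∏ j, Q (x j)) * rhoN ρ n x (f x)
          ≤ ∑ x ∈ blowup ρ n C D, (∏ j, Q (x j)) * D := by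
            refine Finset.sum_le_sum fun x hx => mul_le_mul_of_nonneg_left ?_ (hnn x)
            obtain ⟨y, hy, hyD⟩ := (Finset.mem_filter.1 hx).2
            exact (hfmin x y hy).trans hyD
        _ ≤ ∑ x : Fin n → A, (∏ j, Q (x j)) * D :=
            Finset.sum_le_sum_of_subset_of_nonneg (Finset.subset_univ _)
              fun x _ _ => mul_nonneg (hnn x) hD
        _ = D := by rw [← Finset.sum_mul, sum_words_iid Q hsum, one_mul]
    · rw [prodProb, Finset.mul_sum]
      refine Finset.sum_le_sum fun x _ => ?_
      rw [mul_comm]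
      exact mul_le_mul_of_nonneg_right (hrhoK _ _) (hnn x)
  rw [div_le_iff₀ hKpos]
  rw [h2] at h1
  linarith

theorem isBoundedUnder_logb_massN {A : Type*} [Fintype A] (M : A → ℝ) (hM : ∀ a, 0 < M a)
    (C : ∀ n : ℕ, Finset (Fin n → A)) :
    IsBoundedUnder (· ≤ ·) atTop
      (fun n : ℕ => (1 / (n : ℝ)) * Real.logb 2 (massN M n (C n))) := by
  refine isBoundedUnder_of_eventually_le (a := |Real.logb 2 (∑ a, M a)|) ?_
  filter_upwards [eventually_gt_atTop 0] with n hn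
  have hn' : (0 : ℝ) < n := by exact_mod_cast hn
  rcases (C n).eq_empty_or_nonempty with h | h
  · simp [h, massN]
  · have h1 : massN M n (C n) ≤ (∑ a, M a) ^ n := by
      refine (Finset.sum_le_sum_of_subset_of_nonneg (Finset.subset_univ _)
        fun x _ _ => Finset.prod_nonneg fun i _ => (hM _).le).trans ?_
      rw [sum_words_prod n (fun _ => M)]
      simp
    have h2 := Real.logb_le_logb_of_le (b := 2) (by norm_num) (massN_pos M hM n _ h) h1
    rw [Real.logb_pow] at h2
    rw [one_div, inv_mul_le_iff₀ hn']
    exact h2.trans (mul_le_mul_of_nonneg_left (le_abs_self _) hn'.le)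

/-- Converse part of the sphere-covering theorem. -/
theorem stmt_13 {A : Type*} [Fintype A] [Nonempty A]
    (ρ : A → A → ℝ) (hρ : ∀ a b, 0 ≤ ρ a b)
    (hzero : ∀ a, ∃ b, ρ a b = 0)
    (P : A → ℝ) (hP : ∀ a, 0 < P a) (hPsum : ∑ a, P a = 1)
    (M : A → ℝ) (hM : ∀ a, 0 < M a)
    (D : ℝ) (hD : 0 ≤ D) (hDlt : D < ⨆ p : A × A, ρ p.1 p.2)
    (R : ℝ) (hRlow : rate ρ P M D < (R : EReal))
    (hRhigh : R < Real.logb 2 (∑ a, M a))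
    (C : ∀ n : ℕ, Finset (Fin n → A))
    (hmass : Filter.limsup
      (fun n : ℕ => (1 / (n : ℝ)) * Real.logb 2 (massN M n (C n))) atTop ≤ R) :
    ((Filter.liminf
      (fun n : ℕ =>
        -(1 / (n : ℝ)) * Real.logb 2 (1 - prodProb P n (blowup ρ n (C n) D)))
      atTop : ℝ) : EReal) ≤ Estar ρ P M D R := by
  refine le_sInf ?_
  rintro _ ⟨Q, hQ, hQsum, hrate, rfl⟩
  obtain ⟨R', hRR', hR'⟩ := EReal.lt_iff_exists_real_btwn.1 hrate
  have hRR' : R < R' := EReal.coe_lt_coe_iff.1 hRR'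
  obtain ⟨δ, hδ, hunc⟩ := exists_le_uncovered ρ hρ Q M hQ hQsum hM D R' hD hR'
  have hmass' := eventually_lt_of_limsup_lt (hmass.trans_lt hRR') (isBoundedUnder_logb_massN M hM C)
  rw [EReal.coe_le_coe_iff]
  refine le_of_forall_pos_le_add fun ε hε => ?_
  have hPnn : ∀ (n : ℕ) (B : Finset (Fin n → A)), 0 ≤ prodProb P n B := fun n B =>
    Finset.sum_nonneg fun x _ => Finset.prod_nonneg fun i _ => (hP _).le
  refine liminf_le_of_frequently_le (Eventually.frequently ?_) ?_
  · have hlim : Tendsto (fun n : ℕ => -Real.logb 2 (δ / 2) / (n : ℝ)) atTop (nhds 0) :=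
      tendsto_const_div_atTop_nhds_zero_nat _
    filter_upwards [eventually_gt_atTop 0, hmass',
      eventually_le_prodProb Q P hQ hQsum hP δ (ε / 2) hδ (half_pos hε),
      hlim.eventually_lt_const (half_pos hε)] with n hn hm hst hsmall
    have hn' : (0 : ℝ) < n := by exact_mod_cast hn
    rw [prodProb_compl P hPsum]
    have h1 := hst _ (hunc n (C n) hn hm.le)
    have h2 : 0 < prodProb P n (blowup ρ n (C n) D)ᶜ := by
      by_contra hneg
      have h0 := le_antisymm (not_lt.1 hneg) (hPnn n _)
      rw [h0, mul_zero] at h1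
      linarith
    have h3 := Real.logb_le_logb_of_le (b := 2) (by norm_num) (half_pos hδ) h1
    rw [Real.logb_mul (by positivity) h2.ne', Real.logb_rpow (by norm_num) (by norm_num)] at h3
    rw [div_lt_iff₀ hn'] at hsmall
    rw [neg_mul, one_div, ← mul_neg, inv_mul_le_iff₀ hn']
    linarith
  · refine isBoundedUnder_of ⟨0, fun n => ?_⟩
    have h1 : 0 ≤ prodProb P n (blowup ρ n (C n) D) := hPnn n _
    have h2 := prodProb_compl P hPsum n (blowup ρ n (C n) D)
    have h3 : 0 ≤ 1 - prodProb P n (blowup ρ n (C n) D) := h2 ▸ hPnn n _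
    have h4 := Real.logb_nonpos (b := 2) (by norm_num) h3 (by linarith)
    rw [neg_mul, ge_iff_le, neg_nonneg]
    exact mul_nonpos_of_nonneg_of_nonpos (by positivity) h4
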